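/- arXiv:1104.2168 — 2 statements merged into one kernel-verified Lean document; each statement's English description precedes it below -/
import Mathlib

section
/- Let p be a prime number and let n ≥ 1. In the polynomial ring ℤ[X], the polynomial (1+X)^{p^n} − 1 lies in the (n+1)-st power of the ideal generated by p and X, i.e. (1+X)^{p^n} − 1 ∈ (p, X)^{n+1}. -/
/-- For `n ≥ 1`, `(1+X)^{p^n} − 1 ∈ (p, X)^{n+1}` in `ℤ[X]`. -/
theorem stmt_4 (p : ℕ) (hp : p.Prime) (n : ℕ) (hn : 1 ≤ n) :
    ((1 + Polynomial.X) ^ (p ^ n) - 1 : Polynomial ℤ) ∈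
      (Ideal.span {(p : Polynomial ℤ), Polynomial.X}) ^ (n + 1) := by
  clear hn hp
  have hpI : (p : Polynomial ℤ) ∈ Ideal.span {(p : Polynomial ℤ), Polynomial.X} :=
    Ideal.subset_span (by simp)
  have hXI : (Polynomial.X : Polynomial ℤ) ∈ Ideal.span {(p : Polynomial ℤ), Polynomial.X} :=
    Ideal.subset_span (by simp)
  generalize Ideal.span {(p : Polynomial ℤ), Polynomial.X} = I at *
  induction n with
  | zero => simpa using hXI
  | succ k ih =>
    rw [pow_succ p k, pow_mul]
    generalize ((1 + Polynomial.X) ^ (p ^ k) : Polynomial ℤ) = a at *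
    have ha : a - 1 ∈ I := Ideal.pow_le_self (Nat.succ_ne_zero k) ih
    rw [← mul_geom_sum, pow_succ I (k + 1)]
    refine Ideal.mul_mem_mul ih ?_
    have h : ∑ i ∈ Finset.range p, a ^ i
        = ∑ i ∈ Finset.range p, (a ^ i - 1) + (p : Polynomial ℤ) := by
      simp
    rw [h]
    refine I.add_mem (I.sum_mem fun i _ => ?_) hpI
    rw [← mul_geom_sum]
    exact I.mul_mem_right _ ha
end

section
/- Let p be a prime number and let F ∈ ℤ_p[[X]] be a formal power series. Suppose there are infinitely many integers n ≥ 1 such that the polynomial Φ_{p^n}(1+X) (the p^n-th cyclotomic polynomial evaluated at 1+X), regarded as an element of ℤ_p[[X]], divides F in ℤ_p[[X]]. Then F = 0. -/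
lemma aux_map (p : ℕ) [Fact p.Prime] (n : ℕ) (hn : 1 ≤ n) :
    PowerSeries.map (PadicInt.toZMod (p := p))
      (((Polynomial.cyclotomic (p ^ n) ℤ_[p]).comp (1 + Polynomial.X) :
          Polynomial ℤ_[p]) : PowerSeries ℤ_[p]) = PowerSeries.X ^ (p ^ n - p ^ (n - 1)) := by
  rw [← Polynomial.polynomial_map_coe, Polynomial.map_comp, Polynomial.map_cyclotomic]
  have h1 := Polynomial.cyclotomic_mul_prime_pow_eq (ZMod p) (p := p) (m := 1)
    (Nat.Prime.not_dvd_one Fact.out) (k := n) hn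
  rw [mul_one] at h1
  rw [h1]
  simp [Polynomial.cyclotomic_one]

lemma aux_dvd (p : ℕ) [Fact p.Prime] (F : PowerSeries ℤ_[p])
    (hF : PowerSeries.map (PadicInt.toZMod (p := p)) F = 0) :
    ∃ G, F = PowerSeries.C (p : ℤ_[p]) * G := by
  have h : ∀ i, ∃ c, PowerSeries.coeff i F = (p : ℤ_[p]) * c := by
    intro i
    have h1 : PadicInt.toZMod (PowerSeries.coeff i F) = 0 := by
      rw [← PowerSeries.coeff_map, hF, map_zero]
    have h2 : PowerSeries.coeff i F ∈ RingHom.ker (PadicInt.toZMod (p := p)) := h1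
    rw [PadicInt.ker_toZMod, PadicInt.maximalIdeal_eq_span_p,
      Ideal.mem_span_singleton] at h2
    exact h2
  choose c hc using h
  refine ⟨PowerSeries.mk c, ?_⟩
  ext i
  rw [PowerSeries.coeff_C_mul, PowerSeries.coeff_mk, hc]

lemma aux_le (p : ℕ) (hp : p.Prime) (n : ℕ) (hn : 1 ≤ n) : n ≤ p ^ n - p ^ (n - 1) := by
  obtain ⟨m, rfl⟩ := Nat.exists_eq_add_of_le' hn
  have h2 := hp.two_le
  have h3 : m < p ^ m := Nat.lt_pow_self hp.one_lt
  have : 2 * p ^ m ≤ p ^ (m + 1) := by rw [pow_succ']; gcongr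
  simp only [Nat.add_sub_cancel]
  omega

lemma aux_step (p : ℕ) [Fact p.Prime] (F : PowerSeries ℤ_[p]) (S : Set ℕ) (hS : S.Infinite)
    (h : ∀ n ∈ S, 1 ≤ n ∧
        (((Polynomial.cyclotomic (p ^ n) ℤ_[p]).comp (1 + Polynomial.X) :
          Polynomial ℤ_[p]) : PowerSeries ℤ_[p]) ∣ F) :
    ∃ G, F = PowerSeries.C (p : ℤ_[p]) * G ∧ ∀ n ∈ S, 1 ≤ n ∧
        (((Polynomial.cyclotomic (p ^ n) ℤ_[p]).comp (1 + Polynomial.X) :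
          Polynomial ℤ_[p]) : PowerSeries ℤ_[p]) ∣ G := by
  have hp : p.Prime := Fact.out
  have hC : PowerSeries.C (p : ℤ_[p]) ≠ 0 := by
    intro h0
    have := congrArg (PowerSeries.coeff 0) h0
    simp [hp.ne_zero] at this
  have h0 : PowerSeries.map (PadicInt.toZMod (p := p)) F = 0 := by
    ext i
    obtain ⟨n, hn, hin⟩ := hS.exists_gt i
    obtain ⟨hn1, H, hH⟩ := h n hn
    have := aux_le p hp n hn1
    rw [hH, map_mul, aux_map p n hn1, map_zero]
    exact PowerSeries.X_pow_dvd_iff.mp (dvd_mul_right _ _) i (by omega)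
  obtain ⟨G, rfl⟩ := aux_dvd p F h0
  refine ⟨G, rfl, fun n hn => ⟨(h n hn).1, ?_⟩⟩
  obtain ⟨hn1, H, hH⟩ := h n hn
  have hH0 : PowerSeries.map (PadicInt.toZMod (p := p)) H = 0 := by
    rw [hH, map_mul, aux_map p n hn1] at h0
    exact (mul_eq_zero.mp h0).resolve_left (pow_ne_zero _ PowerSeries.X_ne_zero)
  obtain ⟨K, rfl⟩ := aux_dvd p H hH0
  exact ⟨K, mul_left_cancel₀ hC (by rw [hH]; ring)⟩

lemma aux_pow (p : ℕ) [Fact p.Prime] (S : Set ℕ) (hS : S.Infinite) (k : ℕ) :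
    ∀ (F : PowerSeries ℤ_[p]) (_ : ∀ n ∈ S, 1 ≤ n ∧
        (((Polynomial.cyclotomic (p ^ n) ℤ_[p]).comp (1 + Polynomial.X) :
          Polynomial ℤ_[p]) : PowerSeries ℤ_[p]) ∣ F) (i : ℕ),
      (p : ℤ_[p]) ^ k ∣ PowerSeries.coeff i F := by
  induction k with
  | zero => simp
  | succ k ih =>
    intro F h i
    obtain ⟨G, rfl, hG⟩ := aux_step p F S hS h
    rw [PowerSeries.coeff_C_mul, pow_succ']
    exact mul_dvd_mul_left _ (ih G hG i)

/-- If `F ∈ ℤ_p[[X]]` is divisible in `ℤ_p[[X]]` by `Φ_{p^n}(1+X)` for infinitely many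
`n ≥ 1`, then `F = 0`. -/
theorem stmt_5 (p : ℕ) [Fact p.Prime] (F : PowerSeries ℤ_[p])
    (h : {n : ℕ | 1 ≤ n ∧
        (((Polynomial.cyclotomic (p ^ n) ℤ_[p]).comp (1 + Polynomial.X) :
          Polynomial ℤ_[p]) : PowerSeries ℤ_[p]) ∣ F}.Infinite) :
    F = 0 := by
  ext i
  rw [map_zero]
  by_contra hne
  have hfin : FiniteMultiplicity (p : ℤ_[p]) (PowerSeries.coeff i F) :=
    FiniteMultiplicity.of_not_isUnit PadicInt.prime_p.not_unit hne
  obtain ⟨k, hk⟩ := hfin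
  exact hk (aux_pow p _ h (k + 1) F (fun n hn => hn) i)
end
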